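/- Define the smoothing transform 𝔉_sm on Borel probability measures on [0,∞) as follows: 𝔉_sm μ is the pushforward of the product measure 𝔻 ⊗ Unif[0,1] ⊗ Unif[0,1] ⊗ μ ⊗ μ ⊗ μ under the map ((x,y),u,v,(d₁,d₂,d₃)) ↦ Σ_{k=1}^{3} √δ_k · d_k · 1{u ∈ I_k or v ∈ I_k}, where δ₁ = x, δ₂ = y, δ₃ = 1−x−y, I₁ = [0,δ₁), I₂ = [δ₁,δ₁+δ₂), I₃ = [δ₁+δ₂,1], and 𝔻 is the Dirichlet(1/2,1/2,1/2) distribution. If μ is a Borel probability measure on [0,∞) with finite mean m = ∫ x dμ(x), then 𝔉_sm μ also has mean m; that is, ∫ x d(𝔉_sm μ)(x) = m. Equivalently, the weights satisfy E[W₁ + W₂ + W₃] = 1, where W_k = √δ_k · 1{u ∈ I_k or v ∈ I_k}. -/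

import Mathlib

open MeasureTheory Real Set

/-- The Rayleigh distribution: density `x e^(−x²/2)` on `(0,∞)` w.r.t. Lebesgue. -/
noncomputable def rayleigh : Measure ℝ :=
  volume.withDensity fun x =>
    ENNReal.ofReal (Set.indicator (Set.Ioi (0 : ℝ)) (fun y => y * Real.exp (-y ^ 2 / 2)) x)

/-- The `Dirichlet(1/2,1/2,1/2)` distribution on `ℝ²`: density
`(2π)⁻¹ (xy(1−x−y))^(−1/2)` on the open simplex w.r.t. 2-dim Lebesgue. -/
noncomputable def dirichletHalf : Measure (ℝ × ℝ) :=
  volume.withDensity fun p =>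
    ENNReal.ofReal
      (Set.indicator {q : ℝ × ℝ | 0 < q.1 ∧ 0 < q.2 ∧ q.1 + q.2 < 1}
        (fun q => (2 * π)⁻¹ * (q.1 * q.2 * (1 - q.1 - q.2)) ^ (-(1 / 2) : ℝ)) p)

/-- The uniform distribution on `[0,1]`. -/
noncomputable def unif01 : Measure ℝ := volume.restrict (Set.Icc (0 : ℝ) 1)

/-- The map `((x,y),u,v,(d₁,d₂,d₃)) ↦ Σₖ √δₖ · dₖ · 1{u ∈ Iₖ or v ∈ Iₖ}` where
`δ₁ = x`, `δ₂ = y`, `δ₃ = 1−x−y`, `I₁ = [0,δ₁)`, `I₂ = [δ₁,δ₁+δ₂)`, `I₃ = [δ₁+δ₂,1]`. -/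
noncomputable def smoothingMap : (ℝ × ℝ) × ℝ × ℝ × ℝ × ℝ × ℝ → ℝ := fun q =>
  let δ₁ := q.1.1
  let δ₂ := q.1.2
  let δ₃ := 1 - q.1.1 - q.1.2
  let u := q.2.1
  let v := q.2.2.1
  let d₁ := q.2.2.2.1
  let d₂ := q.2.2.2.2.1
  let d₃ := q.2.2.2.2.2
  Real.sqrt δ₁ * d₁ * (if u ∈ Set.Ico (0 : ℝ) δ₁ ∨ v ∈ Set.Ico (0 : ℝ) δ₁ then 1 else 0) +
  Real.sqrt δ₂ * d₂ * (if u ∈ Set.Ico δ₁ (δ₁ + δ₂) ∨ v ∈ Set.Ico δ₁ (δ₁ + δ₂) then 1 else 0) +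
  Real.sqrt δ₃ * d₃ * (if u ∈ Set.Icc (δ₁ + δ₂) 1 ∨ v ∈ Set.Icc (δ₁ + δ₂) 1 then 1 else 0)

/-- The smoothing transform `𝔉_sm` associated with the BCRT: the law of
`Σₖ √Δₖ Dₖ 1{Pₖ>0}` where `(Δ₁,Δ₂,Δ₃) ~ Dirichlet(1/2,1/2,1/2)`, `D₁,D₂,D₃` i.i.d.
with law `μ`, and, conditionally on `Δ`, `(P₁,P₂,P₃) ~ Multinomial(2;Δ₁,Δ₂,Δ₃)`,
realised via two independent uniforms `u,v` on `[0,1]`. -/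
noncomputable def Fsm (μ : Measure ℝ) : Measure ℝ :=
  Measure.map smoothingMap
    (dirichletHalf.prod (unif01.prod (unif01.prod (μ.prod (μ.prod μ)))))

/-- Arcsine integral. -/
theorem aux_arcsine (a : ℝ) (ha : 0 < a) :
    ∫⁻ y in Ioo 0 a, ENNReal.ofReal ((y * (a - y)) ^ (-(1 / 2) : ℝ)) = ENNReal.ofReal π := by
  have hcont : ContinuousOn (fun y : ℝ => Real.arcsin (2 * y / a - 1)) (Icc 0 a) := by
    apply Continuous.continuousOn
    exact Real.continuous_arcsin.comp (by fun_prop)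
  have hder : ∀ y ∈ Ioo 0 a, HasDerivAt (fun y : ℝ => Real.arcsin (2 * y / a - 1))
      ((y * (a - y)) ^ (-(1 / 2) : ℝ)) y := by
    intro y hy
    have hy0 : 0 < y := hy.1
    have hya : 0 < a - y := by linarith [hy.2]
    have hp : 0 < y * (a - y) := by positivity
    have h1 : HasDerivAt (fun y : ℝ => 2 * y / a - 1) (2 / a) y := by
      have := (((hasDerivAt_id y).const_mul 2).div_const a).sub_const 1
      simpa using this
    have hne1 : 2 * y / a - 1 ≠ -1 := by
      have : 0 < 2 * y / a := by positivity
      linarith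
    have hne2 : 2 * y / a - 1 ≠ 1 := by
      have : 2 * y / a < 2 := by
        rw [div_lt_iff₀ ha]; linarith
      linarith
    have h2 := (Real.hasDerivAt_arcsin hne1 hne2).comp y h1
    refine h2.congr_deriv ?_
    symm
    rw [Real.rpow_neg hp.le, ← Real.sqrt_eq_rpow]
    have : 1 - (2 * y / a - 1) ^ 2 = (2 / a) ^ 2 * (y * (a - y)) := by
      field_simp; ring
    rw [this, Real.sqrt_mul (sq_nonneg (2 / a)), Real.sqrt_sq (by positivity)]
    have := Real.sqrt_pos.2 hp
    field_simp
  have hnn : ∀ y ∈ Ioo 0 a, 0 ≤ (y * (a - y)) ^ (-(1 / 2) : ℝ) := by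
    intro y hy
    have hy0 : 0 < y := hy.1
    have hya : 0 < a - y := by linarith [hy.2]
    positivity
  have hint := intervalIntegral.integrableOn_deriv_of_nonneg hcont hder hnn
  have hint' : IntervalIntegrable (fun y : ℝ => (y * (a - y)) ^ (-(1 / 2) : ℝ)) volume 0 a := by
    rw [intervalIntegrable_iff_integrableOn_Ioc_of_le ha.le]; exact hint
  have hval := intervalIntegral.integral_eq_sub_of_hasDerivAt_of_le ha.le hcont hder hint'
  have e1 : 2 * a / a - 1 = 1 := by field_simp; norm_num
  have e0 : 2 * 0 / a - 1 = -1 := by simp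
  simp only [e1, e0, Real.arcsin_one, Real.arcsin_neg_one] at hval
  rw [intervalIntegral.integral_of_le ha.le, integral_Ioc_eq_integral_Ioo] at hval
  rw [← ofReal_integral_eq_lintegral_ofReal (hint.mono_set Ioo_subset_Ioc_self), hval]
  · congr 1; ring
  · exact (ae_restrict_iff' measurableSet_Ioo).2 (Filter.Eventually.of_forall hnn)

/-- The simplex density. -/
noncomputable def auxDens (p : ℝ × ℝ) : ENNReal :=
  ENNReal.ofReal
      (Set.indicator {q : ℝ × ℝ | 0 < q.1 ∧ 0 < q.2 ∧ q.1 + q.2 < 1}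
        (fun q => (2 * π)⁻¹ * (q.1 * q.2 * (1 - q.1 - q.2)) ^ (-(1 / 2) : ℝ)) p)

theorem aux_measSimplex : MeasurableSet {q : ℝ × ℝ | 0 < q.1 ∧ 0 < q.2 ∧ q.1 + q.2 < 1} :=
  (measurableSet_lt measurable_const measurable_fst).inter
    ((measurableSet_lt measurable_const measurable_snd).inter
      (measurableSet_lt (measurable_fst.add measurable_snd) measurable_const))

theorem aux_measDens : Measurable auxDens := by
  unfold auxDens
  apply ENNReal.measurable_ofReal.comp
  refine Measurable.indicator ?_ aux_measSimplex
  fun_prop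

/-- Weight function. -/
noncomputable def auxG (x : ℝ) : ENNReal :=
  ENNReal.ofReal (√x) * ENNReal.ofReal (x + x * (1 - x))

theorem aux_measG : Measurable auxG := by
  unfold auxG
  fun_prop

theorem aux_inner (x : ℝ) : ∫⁻ y, auxDens (x, y) * auxG x =
    (Ioo (0 : ℝ) 1).indicator (fun x => ENNReal.ofReal ((2 * x - x ^ 2) / 2)) x := by
  by_cases hx : x ∈ Ioo (0 : ℝ) 1
  · have hx0 : 0 < x := hx.1
    have hx1 : 0 < 1 - x := by linarith [hx.2]
    rw [indicator_of_mem hx]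
    have hg : 0 ≤ x + x * (1 - x) := by positivity
    have : ∀ y, auxDens (x, y) * auxG x = (Ioo 0 (1 - x)).indicator
        (fun y => ENNReal.ofReal ((y * ((1 - x) - y)) ^ (-(1 / 2) : ℝ))) y
          * ENNReal.ofReal ((2 * π)⁻¹ * (2 * x - x ^ 2)) := by
      intro y
      by_cases hy : y ∈ Ioo 0 (1 - x)
      · have hy0 : 0 < y := hy.1
        have hy1 : 0 < 1 - x - y := by linarith [hy.2]
        rw [indicator_of_mem hy, auxDens, indicator_of_mem (by
          refine ⟨hx0, hy0, ?_⟩; show x + y < 1; linarith), auxG,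
          ← ENNReal.ofReal_mul (by positivity), ← ENNReal.ofReal_mul (by positivity),
          ← ENNReal.ofReal_mul (by positivity)]
        congr 1
        simp only
        rw [mul_assoc x, Real.mul_rpow hx0.le (by positivity), Real.rpow_neg hx0.le,
          ← Real.sqrt_eq_rpow]
        have := Real.sqrt_pos.2 hx0
        field_simp
        ring
      · rw [indicator_of_notMem hy, auxDens, indicator_of_notMem]
        · simp
        · rintro ⟨h1, h2, h3⟩
          exact hy ⟨h2, by simp only at h3; linarith⟩
    simp_rw [this]
    rw [lintegral_mul_const' _ _ ENNReal.ofReal_ne_top, lintegral_indicator measurableSet_Ioo,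
      aux_arcsine _ hx1, ← ENNReal.ofReal_mul Real.pi_pos.le]
    congr 1
    field_simp
  · rw [indicator_of_notMem hx]
    have : ∀ y, auxDens (x, y) * auxG x = 0 := by
      intro y
      rw [auxDens, indicator_of_notMem]
      · simp
      · rintro ⟨h1, h2, h3⟩
        simp only at h1 h2 h3
        exact hx ⟨h1, by linarith⟩
    simp [this]

theorem aux_J1 : ∫⁻ x, ∫⁻ y, auxDens (x, y) * auxG x = ENNReal.ofReal (1 / 3) := by
  simp_rw [aux_inner]
  rw [lintegral_indicator measurableSet_Ioo, ← ofReal_integral_eq_lintegral_ofReal]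
  · congr 1
    rw [← integral_Ioc_eq_integral_Ioo, ← intervalIntegral.integral_of_le zero_le_one,
      intervalIntegral.integral_div, intervalIntegral.integral_sub
        (by apply Continuous.intervalIntegrable; fun_prop)
        (by apply Continuous.intervalIntegrable; fun_prop)]
    rw [intervalIntegral.integral_const_mul, integral_id, integral_pow]
    norm_num
  · apply Continuous.integrableOn_Icc (a := 0) (b := 1) (by fun_prop) |>.mono_set Ioo_subset_Icc_self
  · refine (ae_restrict_iff' measurableSet_Ioo).2 (Filter.Eventually.of_forall ?_)
    intro x hx
    simp only [Pi.zero_apply]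
    nlinarith [hx.1, hx.2]

theorem aux_dens_symm (x y : ℝ) : auxDens (x, y) = auxDens (y, x) := by
  unfold auxDens
  congr 1
  simp only [indicator, mem_ofPred_eq]
  have : (0 < x ∧ 0 < y ∧ x + y < 1) ↔ (0 < y ∧ 0 < x ∧ y + x < 1) := by
    rw [add_comm x y]; tauto
  simp only [this]
  split_ifs
  · congr 2; ring
  · rfl

theorem aux_dens_refl (x y : ℝ) : auxDens (x, 1 - x - y) = auxDens (x, y) := by
  unfold auxDens
  congr 1
  simp only [indicator, mem_ofPred_eq]
  have : (0 < x ∧ 0 < 1 - x - y ∧ x + (1 - x - y) < 1) ↔ (0 < x ∧ 0 < y ∧ x + y < 1) := by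
    constructor <;> rintro ⟨h1, h2, h3⟩ <;> refine ⟨h1, ?_, ?_⟩ <;> linarith
  simp only [this]
  split_ifs
  · congr 2; ring
  · rfl

theorem aux_J2 : ∫⁻ x, ∫⁻ y, auxDens (x, y) * auxG y = ENNReal.ofReal (1 / 3) := by
  rw [lintegral_lintegral_swap]
  · simp_rw [← aux_J1]
    refine lintegral_congr fun y => lintegral_congr fun x => ?_
    rw [aux_dens_symm]
  · exact ((aux_measDens.comp (measurable_fst.prodMk measurable_snd)).mul
      (aux_measG.comp measurable_snd)).aemeasurable

theorem aux_J3 : ∫⁻ x, ∫⁻ y, auxDens (x, y) * auxG (1 - x - y) = ENNReal.ofReal (1 / 3) := by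
  rw [← aux_J2]
  refine lintegral_congr fun x => ?_
  rw [← lintegral_sub_left_eq_self (fun y => auxDens (x, y) * auxG y) (1 - x)]
  refine lintegral_congr fun y => ?_
  rw [aux_dens_refl]

theorem aux_total : ∫⁻ p, (auxG p.1 + auxG p.2 + auxG (1 - p.1 - p.2)) ∂dirichletHalf = 1 := by
  have h1 : Measurable fun p : ℝ × ℝ => auxDens p * auxG p.1 :=
    aux_measDens.mul (aux_measG.comp measurable_fst)
  have h2 : Measurable fun p : ℝ × ℝ => auxDens p * auxG p.2 :=
    aux_measDens.mul (aux_measG.comp measurable_snd)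
  have h3 : Measurable fun p : ℝ × ℝ => auxDens p * auxG (1 - p.1 - p.2) :=
    aux_measDens.mul (aux_measG.comp (by fun_prop))
  have e : dirichletHalf = volume.withDensity auxDens := rfl
  rw [e, lintegral_withDensity_eq_lintegral_mul _ aux_measDens]
  · simp only [Pi.mul_apply, mul_add]
    rw [lintegral_add_right _ h3, lintegral_add_right _ h2, Measure.volume_eq_prod,
      lintegral_prod _ h1.aemeasurable, lintegral_prod _ h2.aemeasurable,
      lintegral_prod _ h3.aemeasurable, aux_J1, aux_J2, aux_J3,
      ← ENNReal.ofReal_add (by norm_num) (by norm_num),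
      ← ENNReal.ofReal_add (by norm_num) (by norm_num)]
    norm_num
  · exact ((aux_measG.comp measurable_fst).add (aux_measG.comp measurable_snd)).add
      (aux_measG.comp (by fun_prop))

instance aux_prob : IsProbabilityMeasure unif01 := ⟨by simp [unif01]⟩

/-- Indicator that one of two samples hits `I`. -/
theorem aux_hit (I : Set ℝ) (hI : MeasurableSet I) (t : ℝ) (ht0 : 0 ≤ t) (ht1 : t ≤ 1)
    (h : unif01 I = ENNReal.ofReal t) (c : ENNReal) :
    ∫⁻ u, ∫⁻ v, c * (I ×ˢ univ ∪ univ ×ˢ I).indicator 1 (u, v) ∂unif01 ∂unif01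
      = c * ENNReal.ofReal (t + t * (1 - t)) := by
  have hm : MeasurableSet (I ×ˢ univ ∪ univ ×ˢ I : Set (ℝ × ℝ)) :=
    (hI.prod MeasurableSet.univ).union (MeasurableSet.univ.prod hI)
  have hmf : Measurable ((I ×ˢ univ ∪ univ ×ˢ I : Set (ℝ × ℝ)).indicator (1 : ℝ × ℝ → ENNReal)) :=
    measurable_one.indicator hm
  have hc : unif01 Iᶜ = ENNReal.ofReal (1 - t) := by
    rw [prob_compl_eq_one_sub hI, h, ENNReal.ofReal_sub _ ht0, ENNReal.ofReal_one]
  rw [← lintegral_prod (f := fun p => c * (I ×ˢ univ ∪ univ ×ˢ I).indicator 1 p)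
    (hmf.const_mul c).aemeasurable, lintegral_const_mul _ hmf, lintegral_indicator_one hm]
  have : (I ×ˢ univ ∪ univ ×ˢ I : Set (ℝ × ℝ)) = I ×ˢ univ ∪ Iᶜ ×ˢ I := by
    ext ⟨a, b⟩; simp; tauto
  rw [this, measure_union _ (hI.compl.prod hI), Measure.prod_prod, Measure.prod_prod, h, hc,
    measure_univ, mul_one, ← ENNReal.ofReal_mul (by linarith), ← ENNReal.ofReal_add ht0
      (mul_nonneg (by linarith) ht0), mul_comm (1 - t)]
  rw [Set.disjoint_left]
  rintro ⟨a, b⟩ ⟨h1, _⟩ ⟨h2, _⟩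
  exact h2 h1

theorem aux_unifIco (a b : ℝ) (ha : 0 ≤ a) (hb : b ≤ 1) :
    unif01 (Ico a b) = ENNReal.ofReal (b - a) := by
  rw [unif01, Measure.restrict_apply measurableSet_Ico,
    inter_eq_left.2 (Ico_subset_Icc_self.trans (Icc_subset_Icc ha hb)), Real.volume_Ico]

theorem aux_unifIcc (a b : ℝ) (ha : 0 ≤ a) (hb : b ≤ 1) :
    unif01 (Icc a b) = ENNReal.ofReal (b - a) := by
  rw [unif01, Measure.restrict_apply measurableSet_Icc,
    inter_eq_left.2 (Icc_subset_Icc ha hb), Real.volume_Icc]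

theorem aux_lin (μ : Measure ℝ) [IsProbabilityMeasure μ] (hpos : ∀ᵐ x ∂μ, 0 ≤ x)
    (a b c : ℝ) (ha : 0 ≤ a) (hb : 0 ≤ b) (hc : 0 ≤ c) :
    ∫⁻ d₁, ∫⁻ d₂, ∫⁻ d₃, ENNReal.ofReal (a * d₁ + b * d₂ + c * d₃) ∂μ ∂μ ∂μ
      = (ENNReal.ofReal a + ENNReal.ofReal b + ENNReal.ofReal c) *
        ∫⁻ x, ENNReal.ofReal x ∂μ := by
  have h3 : ∀ k : ℝ, 0 ≤ k → ∀ r : ℝ, 0 ≤ r →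
      ∫⁻ d₃, ENNReal.ofReal (r + k * d₃) ∂μ
        = ENNReal.ofReal r + ENNReal.ofReal k * ∫⁻ x, ENNReal.ofReal x ∂μ := by
    intro k hk r hr
    rw [← lintegral_const_mul _ ENNReal.measurable_ofReal]
    have : ENNReal.ofReal r = ∫⁻ _, ENNReal.ofReal r ∂μ := by simp
    rw [this, ← lintegral_add_left measurable_const]
    apply lintegral_congr_ae
    filter_upwards [hpos] with d hd
    rw [ENNReal.ofReal_add hr (mul_nonneg hk hd), ENNReal.ofReal_mul hk]
  have s2 : ∀ d₁ : ℝ, 0 ≤ d₁ →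
      ∫⁻ d₂, ∫⁻ d₃, ENNReal.ofReal (a * d₁ + b * d₂ + c * d₃) ∂μ ∂μ
        = ENNReal.ofReal (0 + a * d₁) + (ENNReal.ofReal b * ∫⁻ x, ENNReal.ofReal x ∂μ) +
          ENNReal.ofReal c * ∫⁻ x, ENNReal.ofReal x ∂μ := by
    intro d₁ hd₁
    rw [zero_add, ← h3 b hb _ (mul_nonneg ha hd₁)]
    have : ENNReal.ofReal c * ∫⁻ x, ENNReal.ofReal x ∂μ
      = ∫⁻ _, (ENNReal.ofReal c * ∫⁻ x, ENNReal.ofReal x ∂μ) ∂μ := by simp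
    rw [this, ← lintegral_add_right _ measurable_const]
    apply lintegral_congr_ae
    filter_upwards [hpos] with d₂ hd₂
    rw [h3 c hc _ (by positivity)]
  have s1 : ∫⁻ d₁, ∫⁻ d₂, ∫⁻ d₃, ENNReal.ofReal (a * d₁ + b * d₂ + c * d₃) ∂μ ∂μ ∂μ
      = ∫⁻ d₁, (ENNReal.ofReal (0 + a * d₁) + (ENNReal.ofReal b * ∫⁻ x, ENNReal.ofReal x ∂μ) +
          ENNReal.ofReal c * ∫⁻ x, ENNReal.ofReal x ∂μ) ∂μ := by
    apply lintegral_congr_ae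
    filter_upwards [hpos] with d₁ hd₁
    exact s2 d₁ hd₁
  rw [s1, lintegral_add_right _ measurable_const, lintegral_add_right _ measurable_const,
    h3 a ha 0 le_rfl]
  simp only [lintegral_const, measure_univ, mul_one, ENNReal.ofReal_zero, zero_add]
  ring

theorem aux_measMap : Measurable smoothingMap := by
  unfold smoothingMap
  have hIco : ∀ f g h : (ℝ × ℝ) × ℝ × ℝ × ℝ × ℝ × ℝ → ℝ, Measurable f → Measurable g →
      Measurable h → MeasurableSet {q | f q ∈ Ico (g q) (h q)} := fun f g h hf hg hh =>
    (measurableSet_le hg hf).inter (measurableSet_lt hf hh)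
  have hIcc : ∀ f g h : (ℝ × ℝ) × ℝ × ℝ × ℝ × ℝ × ℝ → ℝ, Measurable f → Measurable g →
      Measurable h → MeasurableSet {q | f q ∈ Icc (g q) (h q)} := fun f g h hf hg hh =>
    (measurableSet_le hg hf).inter (measurableSet_le hf hh)
  refine Measurable.add (Measurable.add ?_ ?_) ?_
  · refine Measurable.mul (by fun_prop) (Measurable.ite ?_ measurable_const measurable_const)
    exact (hIco _ _ _ (by fun_prop) (by fun_prop) (by fun_prop)).union
      (hIco _ _ _ (by fun_prop) (by fun_prop) (by fun_prop))
  · refine Measurable.mul (by fun_prop) (Measurable.ite ?_ measurable_const measurable_const)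
    exact (hIco _ _ _ (by fun_prop) (by fun_prop) (by fun_prop)).union
      (hIco _ _ _ (by fun_prop) (by fun_prop) (by fun_prop))
  · refine Measurable.mul (by fun_prop) (Measurable.ite ?_ measurable_const measurable_const)
    exact (hIcc _ _ _ (by fun_prop) (by fun_prop) (by fun_prop)).union
      (hIcc _ _ _ (by fun_prop) (by fun_prop) (by fun_prop))

instance aux_sfin : SFinite dirichletHalf := by
  unfold dirichletHalf; infer_instance

theorem aux_simplex_ae : ∀ᵐ p ∂dirichletHalf, 0 < p.1 ∧ 0 < p.2 ∧ p.1 + p.2 < 1 := by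
  have e : dirichletHalf = volume.withDensity auxDens := rfl
  rw [e, ae_withDensity_iff aux_measDens]
  refine Filter.Eventually.of_forall fun p hp => ?_
  by_contra hcon
  apply hp
  rw [auxDens, indicator_of_notMem (by exact hcon), ENNReal.ofReal_zero]

/-- The mean weights given the simplex point. -/
theorem aux_weights (x y : ℝ) (hx : 0 < x) (hy : 0 < y) (hxy : x + y < 1)
    (μ : Measure ℝ) [IsProbabilityMeasure μ] (hpos : ∀ᵐ x ∂μ, 0 ≤ x) :
    ∫⁻ u, ∫⁻ v, ∫⁻ d₁, ∫⁻ d₂, ∫⁻ d₃,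
      ENNReal.ofReal (smoothingMap ((x, y), u, v, d₁, d₂, d₃)) ∂μ ∂μ ∂μ ∂unif01 ∂unif01
      = (auxG x + auxG y + auxG (1 - x - y)) * ∫⁻ x, ENNReal.ofReal x ∂μ := by
  have key : ∀ u v, ∫⁻ d₁, ∫⁻ d₂, ∫⁻ d₃,
      ENNReal.ofReal (smoothingMap ((x, y), u, v, d₁, d₂, d₃)) ∂μ ∂μ ∂μ
      = (ENNReal.ofReal √x *
          (Ico 0 x ×ˢ univ ∪ univ ×ˢ Ico 0 x : Set (ℝ × ℝ)).indicator 1 (u, v)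
        + ENNReal.ofReal √y *
          (Ico x (x + y) ×ˢ univ ∪ univ ×ˢ Ico x (x + y) : Set (ℝ × ℝ)).indicator 1 (u, v)
        + ENNReal.ofReal √(1 - x - y) *
          (Icc (x + y) 1 ×ˢ univ ∪ univ ×ˢ Icc (x + y) 1 : Set (ℝ × ℝ)).indicator 1 (u, v)) *
        ∫⁻ x, ENNReal.ofReal x ∂μ := by
    intro u v
    have conv : ∀ (s : ℝ) (I : Set ℝ) [Decidable (u ∈ I ∨ v ∈ I)], 0 ≤ s →
        ENNReal.ofReal (s * (if u ∈ I ∨ v ∈ I then 1 else 0)) = ENNReal.ofReal s *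
        (I ×ˢ univ ∪ univ ×ˢ I : Set (ℝ × ℝ)).indicator 1 (u, v) := by
      intro s I _ hs
      by_cases h : u ∈ I ∨ v ∈ I
      · rw [if_pos h, indicator_of_mem (by simpa using h)]; simp
      · rw [if_neg h, indicator_of_notMem (by simpa using h)]; simp
    rw [← conv _ _ (Real.sqrt_nonneg _), ← conv _ _ (Real.sqrt_nonneg _),
      ← conv _ _ (Real.sqrt_nonneg _), ← aux_lin μ hpos]
    · refine lintegral_congr fun d₁ => lintegral_congr fun d₂ => lintegral_congr fun d₃ => ?_
      congr 1
      simp only [smoothingMap]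
      ring
    all_goals
      refine mul_nonneg (Real.sqrt_nonneg _) ?_
      split_ifs <;> norm_num
  simp_rw [key]
  have hm : ∀ (c : ENNReal) (I : Set ℝ), MeasurableSet I → Measurable fun p : ℝ × ℝ =>
      c * (I ×ˢ univ ∪ univ ×ˢ I : Set (ℝ × ℝ)).indicator 1 p := fun c I hI =>
    (measurable_one.indicator
      ((hI.prod MeasurableSet.univ).union (MeasurableSet.univ.prod hI))).const_mul c
  have m1 := hm (ENNReal.ofReal √x) (Ico 0 x) measurableSet_Ico
  have m2 := hm (ENNReal.ofReal √y) (Ico x (x + y)) measurableSet_Ico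
  have m3 := hm (ENNReal.ofReal √(1 - x - y)) (Icc (x + y) 1) measurableSet_Icc
  have i1 := aux_hit (Ico 0 x) measurableSet_Ico x hx.le (by linarith)
    (by rw [aux_unifIco _ _ le_rfl (by linarith), sub_zero]) (ENNReal.ofReal √x)
  have i2 := aux_hit (Ico x (x + y)) measurableSet_Ico y hy.le (by linarith)
    (by rw [aux_unifIco _ _ hx.le hxy.le]; congr 1; ring) (ENNReal.ofReal √y)
  have i3 := aux_hit (Icc (x + y) 1) measurableSet_Icc (1 - x - y) (by linarith) (by linarith)
    (by rw [aux_unifIcc _ _ (by linarith) le_rfl]; congr 1; ring) (ENNReal.ofReal √(1 - x - y))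
  rw [← lintegral_prod _ m1.aemeasurable] at i1
  rw [← lintegral_prod _ m2.aemeasurable] at i2
  rw [← lintegral_prod _ m3.aemeasurable] at i3
  have m0 : Measurable fun p : ℝ × ℝ => (ENNReal.ofReal √x *
          (Ico 0 x ×ˢ univ ∪ univ ×ˢ Ico 0 x : Set (ℝ × ℝ)).indicator 1 p
        + ENNReal.ofReal √y *
          (Ico x (x + y) ×ˢ univ ∪ univ ×ˢ Ico x (x + y) : Set (ℝ × ℝ)).indicator 1 p
        + ENNReal.ofReal √(1 - x - y) *
          (Icc (x + y) 1 ×ˢ univ ∪ univ ×ˢ Icc (x + y) 1 : Set (ℝ × ℝ)).indicator 1 p) :=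
    (m1.add m2).add m3
  have m := ((m1.add m2).add m3).mul_const (∫⁻ x, ENNReal.ofReal x ∂μ)
  have hp := lintegral_prod (μ := unif01) (ν := unif01) _ m.aemeasurable
  simp only [Pi.add_apply] at hp
  rw [← hp, lintegral_mul_const _ m0, lintegral_add_right _ m3,
    lintegral_add_right _ m2, i1, i2, i3]
  rfl

/-- The smoothing transform `𝔉_sm` preserves the mean: if `μ` is a Borel probability
measure on `[0,∞)` with finite mean, then `𝔉_sm μ` has the same mean. -/
theorem smoothing_preserves_mean (μ : Measure ℝ) [IsProbabilityMeasure μ]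
    (hsupp : μ (Set.Iio 0) = 0) (hint : Integrable (fun x => x) μ) :
    ∫ x, x ∂(Fsm μ) = ∫ x, x ∂μ := by
  have hpos : ∀ᵐ x ∂μ, 0 ≤ x := by
    rw [ae_iff]
    have : {a : ℝ | ¬ 0 ≤ a} = Iio 0 := by ext; simp
    rw [this]; exact hsupp
  have hM := aux_measMap.ennreal_ofReal
  have hF : ∫⁻ x, ENNReal.ofReal x ∂(Fsm μ) = ∫⁻ x, ENNReal.ofReal x ∂μ := by
    rw [Fsm, lintegral_map ENNReal.measurable_ofReal aux_measMap,
      lintegral_prod _ hM.aemeasurable]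
    have e : ∀ p : ℝ × ℝ, 0 < p.1 ∧ 0 < p.2 ∧ p.1 + p.2 < 1 →
        ∫⁻ r, ENNReal.ofReal (smoothingMap (p, r))
          ∂(unif01.prod (unif01.prod (μ.prod (μ.prod μ))))
        = (auxG p.1 + auxG p.2 + auxG (1 - p.1 - p.2)) * ∫⁻ x, ENNReal.ofReal x ∂μ := by
      rintro ⟨x, y⟩ ⟨hx, hy, hxy⟩
      rw [← aux_weights x y hx hy hxy μ hpos]
      rw [lintegral_prod _ (by have := aux_measMap; fun_prop)]
      refine lintegral_congr fun u => ?_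
      rw [lintegral_prod _ (by have := aux_measMap; fun_prop)]
      refine lintegral_congr fun v => ?_
      rw [lintegral_prod _ (by have := aux_measMap; fun_prop)]
      refine lintegral_congr fun d₁ => ?_
      rw [lintegral_prod _ (by have := aux_measMap; fun_prop)]
    rw [lintegral_congr_ae (g := fun p : ℝ × ℝ =>
      (auxG p.1 + auxG p.2 + auxG (1 - p.1 - p.2)) * ∫⁻ x, ENNReal.ofReal x ∂μ)
      (by filter_upwards [aux_simplex_ae] with p hp using e p hp), lintegral_mul_const,
      aux_total, one_mul]
    exact ((aux_measG.comp measurable_fst).add (aux_measG.comp measurable_snd)).add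
      (aux_measG.comp (by fun_prop))
  have hFpos : ∀ᵐ x ∂(Fsm μ), 0 ≤ x := by
    rw [Fsm, ae_map_iff aux_measMap.aemeasurable measurableSet_Ici]
    have q1 : ∀ᵐ r ∂(μ.prod (μ.prod μ)), 0 ≤ r.1 ∧ 0 ≤ r.2.1 ∧ 0 ≤ r.2.2 := by
      filter_upwards [Measure.quasiMeasurePreserving_fst.ae hpos,
        Measure.quasiMeasurePreserving_snd.ae (Measure.quasiMeasurePreserving_fst.ae hpos),
        Measure.quasiMeasurePreserving_snd.ae (Measure.quasiMeasurePreserving_snd.ae hpos)]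
        with r h1 h2 h3 using ⟨h1, h2, h3⟩
    have q2 : ∀ᵐ q ∂(dirichletHalf.prod (unif01.prod (unif01.prod (μ.prod (μ.prod μ))))),
        0 ≤ q.2.2.2.1 ∧ 0 ≤ q.2.2.2.2.1 ∧ 0 ≤ q.2.2.2.2.2 :=
      Measure.quasiMeasurePreserving_snd.ae (Measure.quasiMeasurePreserving_snd.ae
        (Measure.quasiMeasurePreserving_snd.ae q1))
    filter_upwards [q2] with q hq
    obtain ⟨h1, h2, h3⟩ := hq
    have hi : ∀ (P : Prop) [Decidable P], (0 : ℝ) ≤ if P then 1 else 0 := by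
      intro P _; split_ifs <;> norm_num
    simp only [smoothingMap]
    refine add_nonneg (add_nonneg ?_ ?_) ?_ <;>
      exact mul_nonneg (mul_nonneg (Real.sqrt_nonneg _) (by assumption)) (hi _)
  rw [integral_eq_lintegral_of_nonneg_ae hFpos aestronglyMeasurable_id,
    integral_eq_lintegral_of_nonneg_ae hpos aestronglyMeasurable_id, hF]
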